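/- Let Ω be a bounded open set in ℝ^N with C¹ boundary, let γ be a smooth function and a a smooth bounded vector field, both defined on a neighborhood of the closure of Ω, with div(e^γ a) = 0 in Ω, and set c := −∇γ + a. Let λ > 0 and let u be a smooth function on a neighborhood of the closure of Ω with 0 ≤ u in Ω, sup_Ω u < 1, u = 0 on ∂Ω, satisfying −Δu + c·∇u = λ/(1−u)² in Ω. Then for every t > 0: (2t+1) ∫_Ω e^γ |∇u|² (1−u)^{−(2t+2)} dx = λ ∫_Ω e^γ (1−u)^{−2} ((1−u)^{−(2t+1)} − 1) dx. -/

import Mathlib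

open MeasureTheory Real
open scoped RealInnerProductSpace

/-- Divergence of a vector field on `ℝ^N`: `div F = ∑ i ∂ᵢ Fᵢ`. -/
noncomputable def vdiv {N : ℕ} (F : EuclideanSpace ℝ (Fin N) → Fin N → ℝ)
    (x : EuclideanSpace ℝ (Fin N)) : ℝ :=
  ∑ i, fderiv ℝ (fun y => F y i) x (EuclideanSpace.single i 1)

/-- Laplacian `Δf = div(∇f)`. -/
noncomputable def lap {N : ℕ} (f : EuclideanSpace ℝ (Fin N) → ℝ)
    (x : EuclideanSpace ℝ (Fin N)) : ℝ :=
  vdiv (fun y i => gradient f y i) x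

/-- `Ω` has `C¹` boundary: near each boundary point, `Ω` is the sublevel set of a `C¹`
function with nonvanishing differential. -/
def HasC1Boundary {N : ℕ} (Ω : Set (EuclideanSpace ℝ (Fin N))) : Prop :=
  ∀ x ∈ frontier Ω, ∃ (V : Set (EuclideanSpace ℝ (Fin N)))
    (f : EuclideanSpace ℝ (Fin N) → ℝ),
      IsOpen V ∧ x ∈ V ∧ ContDiffOn ℝ 1 f V ∧ (∀ y ∈ V, fderiv ℝ f y ≠ 0) ∧
      Ω ∩ V = {y ∈ V | f y < 0}
open Filter Topology in
/-- The integral of a directional derivative of a compactly supported `C¹` function vanishes. -/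
theorem integral_fderiv_eq_zero_of_hasCompactSupport {E : Type*} [NormedAddCommGroup E]
    [NormedSpace ℝ E] [FiniteDimensional ℝ E] [MeasurableSpace E] [BorelSpace E]
    (μ : Measure E) [μ.IsAddHaarMeasure] {f : E → ℝ} (hf : ContDiff ℝ 1 f)
    (hs : HasCompactSupport f) (e : E) : ∫ x, fderiv ℝ f x e ∂μ = 0 := by
  have hi : Integrable (fun x => fderiv ℝ f x e) μ :=
    ((hf.continuous_fderiv (by simp)).clm_apply continuous_const).integrable_of_hasCompactSupport
      (hs.fderiv_apply (𝕜 := ℝ) e)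
  have h := integral_mul_fderiv_eq_neg_fderiv_mul_of_integrable (𝕜 := ℝ) (μ := μ)
    (f := fun _ => (1 : ℝ)) (g := f) (v := e) (by simp) (by simpa using hi)
    (by simpa using hf.continuous.integrable_of_hasCompactSupport hs)
    (fun x _ => differentiableAt_const _) (fun x _ => hf.differentiable (by simp) x)
  simpa using h

open Filter Topology in
/-- A smooth cutoff which vanishes on `[-1, 1]` and equals `1` outside `(-2, 2)`. -/
theorem exists_smooth_cutoff_near_zero : ∃ (η : ℝ → ℝ) (C : ℝ), ContDiff ℝ 1 η ∧
    (∀ s, |s| ≤ 1 → η s = 0) ∧ (∀ s, 2 < |s| → η s = 1 ∧ deriv η s = 0) ∧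
    (∀ s, |η s| ≤ 1) ∧ ∀ s, |deriv η s * s| ≤ C := by
  let b : ContDiffBump (0 : ℝ) := ⟨1, 2, one_pos, one_lt_two⟩
  have hb : ContDiff ℝ 1 (b : ℝ → ℝ) := b.contDiff
  have hη : ContDiff ℝ 1 (fun s => 1 - b s) := contDiff_const.sub hb
  have hd : ∀ s, deriv (fun s => 1 - b s) s = - deriv b s := fun s => by simp
  have hc : Continuous (fun s => deriv b s * s) :=
    (hb.continuous_deriv le_rfl).mul continuous_id
  obtain ⟨C, hC⟩ :=
    (b.hasCompactSupport.deriv.mul_right (f' := fun s => s)).exists_bound_of_continuous hc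
  refine ⟨fun s => 1 - b s, C, hη, fun s hs => ?_, fun s hs => ⟨?_, ?_⟩, fun s => ?_, fun s => ?_⟩
  · dsimp only; rw [b.one_of_mem_closedBall (by simpa [b] using hs), sub_self]
  · dsimp only; rw [b.zero_of_le_dist (by simpa [b] using hs.le), sub_zero]
  · have : (b : ℝ → ℝ) =ᶠ[𝓝 s] fun _ => 0 := by
      filter_upwards [continuous_abs.continuousAt.eventually (lt_mem_nhds hs)] with y hy
      exact b.zero_of_le_dist (by simpa [b] using (show 2 < |y| from hy).le)
    rw [hd, this.deriv_eq]; simp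
  · rw [abs_le]; constructor <;> linarith [b.nonneg (x := s), b.le_one (x := s)]
  · rw [hd, neg_mul, abs_neg]; exact hC s

open Filter Topology in
/-- Divergence theorem in one direction for a product `v * k` whose nonnegative factor `v` vanishes
on the boundary of a bounded open set. -/
theorem setIntegral_fderiv_mul_eq_zero {E : Type*} [NormedAddCommGroup E]
    [NormedSpace ℝ E] [FiniteDimensional ℝ E] [MeasurableSpace E] [BorelSpace E]
    (μ : Measure E) [μ.IsAddHaarMeasure] {Ω U : Set E} (hΩ : IsOpen Ω)
    (hb : Bornology.IsBounded Ω) (hU : IsOpen U) (hΩU : closure Ω ⊆ U) {v k : E → ℝ}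
    (hv : ContDiffOn ℝ 1 v U) (hk : ContDiffOn ℝ 1 k U) (hv0 : ∀ x ∈ Ω, 0 ≤ v x)
    (hvb : ∀ x ∈ frontier Ω, v x = 0) (e : E) :
    ∫ x in Ω, fderiv ℝ (fun y => v y * k y) x e ∂μ = 0 := by
  obtain ⟨η, C, hη, hη0, hη1, hηb, hηC⟩ := exists_smooth_cutoff_near_zero
  have hΩU' : Ω ⊆ U := subset_closure.trans hΩU
  have hK : IsCompact (closure Ω) := hb.isCompact_closure
  have hvd : ∀ x ∈ U, HasFDerivAt v (fderiv ℝ v x) x := fun x hx =>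
    ((hv.differentiableOn one_ne_zero).differentiableAt (hU.mem_nhds hx)).hasFDerivAt
  have hkd : ∀ x ∈ U, HasFDerivAt k (fderiv ℝ k x) x := fun x hx =>
    ((hk.differentiableOn one_ne_zero).differentiableAt (hU.mem_nhds hx)).hasFDerivAt
  let F : ℕ → E → ℝ := fun n => Ω.indicator fun x => η (n * v x) * (v x * k x)
  have hS : ∀ n : ℕ, ∃ K, IsCompact K ∧ K ⊆ Ω ∧ ∀ x ∉ K, F n x = 0 := by
    intro n
    refine ⟨closure Ω ∩ (fun x => n * v x) ⁻¹' {s | 1 ≤ |s|}, ?_, ?_, ?_⟩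
    · refine hK.of_isClosed_subset ?_ Set.inter_subset_left
      exact (continuousOn_const.mul (hv.continuousOn.mono hΩU)).preimage_isClosed_of_isClosed
        isClosed_closure (isClosed_le continuous_const continuous_abs)
    · rintro x ⟨hx, hx1⟩
      by_contra hxΩ
      have : v x = 0 := hvb x ⟨hx, by rwa [hΩ.interior_eq]⟩
      norm_num [this] at hx1
    · intro x hx
      by_cases hxΩ : x ∈ Ω
      · have : |n * v x| ≤ 1 := by
          by_contra! h
          exact hx ⟨subset_closure hxΩ, h.le⟩
        simp [F, hη0 _ this]
      · simp [F, hxΩ]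
  have hFΩ : ∀ n : ℕ, ∀ x ∈ Ω, F n =ᶠ[𝓝 x] fun x => η (n * v x) * (v x * k x) := fun n x hx => by
    filter_upwards [hΩ.mem_nhds hx] with y hy
    simp [F, hy]
  have hFK : ∀ n : ℕ, ∀ x ∉ Ω, F n =ᶠ[𝓝 x] fun _ => 0 := fun n x hx => by
    obtain ⟨K, hKc, hKΩ, hK0⟩ := hS n
    filter_upwards [hKc.isClosed.isOpen_compl.mem_nhds (fun h => hx (hKΩ h))] with y hy
    exact hK0 y hy
  have hF1 : ∀ n, ContDiff ℝ 1 (F n) := fun n => contDiff_iff_contDiffAt.2 fun x => by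
    by_cases hx : x ∈ Ω
    · have h1 := hv.contDiffAt (hU.mem_nhds (hΩU' hx))
      have h2 := hk.contDiffAt (hU.mem_nhds (hΩU' hx))
      exact ((hη.contDiffAt.comp x (contDiffAt_const.mul h1)).mul (h1.mul h2)).congr_of_eventuallyEq
        (hFΩ n x hx)
    · exact contDiffAt_const.congr_of_eventuallyEq (hFK n x hx)
  have hFc : ∀ n, HasCompactSupport (F n) := fun n => by
    obtain ⟨K, hKc, -, hK0⟩ := hS n
    exact HasCompactSupport.intro hKc hK0
  have hF' : ∀ n : ℕ, ∀ x ∈ Ω, fderiv ℝ (F n) x e =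
      (deriv η (n * v x) * (n * v x)) * (k x * fderiv ℝ v x e) +
        η (n * v x) * (v x * fderiv ℝ k x e + k x * fderiv ℝ v x e) := fun n x hx => by
    rw [(hFΩ n x hx).fderiv_eq]
    have h1 := hvd x (hΩU' hx)
    have h2 := hkd x (hΩU' hx)
    have h3 : HasDerivAt η (deriv η (n * v x)) (n * v x) :=
      (hη.differentiable one_ne_zero _).hasDerivAt
    have h4 := (h3.comp_hasFDerivAt x (h1.const_mul (n : ℝ))).mul (h1.mul h2)
    have h5 : fderiv ℝ (fun x => η (n * v x) * (v x * k x)) x = _ := h4.fderiv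
    rw [h5]
    simp
    ring
  have hL : ∀ x ∈ Ω, fderiv ℝ (fun y => v y * k y) x e =
      v x * fderiv ℝ k x e + k x * fderiv ℝ v x e := fun x hx => by
    have h5 : fderiv ℝ (fun y => v y * k y) x = _ :=
      ((hvd x (hΩU' hx)).mul (hkd x (hΩU' hx))).fderiv
    rw [h5]
    simp
  have hF_integral : ∀ n, ∫ x in Ω, fderiv ℝ (F n) x e ∂μ = 0 := fun n => by
    rw [setIntegral_eq_integral_of_forall_compl_eq_zero fun x hx => by
      rw [(hFK n x hx).fderiv_eq]; simp]
    exact integral_fderiv_eq_zero_of_hasCompactSupport μ (hF1 n) (hFc n) e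
  have hv'c := (hv.continuousOn_fderiv_of_isOpen hU le_rfl).clm_apply
    (continuousOn_const (c := e))
  have hk'c := (hk.continuousOn_fderiv_of_isOpen hU le_rfl).clm_apply
    (continuousOn_const (c := e))
  obtain ⟨A, hA⟩ := hK.exists_bound_of_continuousOn ((hk.continuousOn.mul hv'c).mono hΩU)
  obtain ⟨B, hB⟩ := hK.exists_bound_of_continuousOn
    (((hv.continuousOn.mul hk'c).add (hk.continuousOn.mul hv'c)).mono hΩU)
  have hfin : IsFiniteMeasure (μ.restrict Ω) :=
    ⟨by simpa using hb.measure_lt_top⟩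
  have hlim := tendsto_integral_of_dominated_convergence (μ := μ.restrict Ω)
    (F := fun n x => fderiv ℝ (F n) x e) (f := fun x => fderiv ℝ (fun y => v y * k y) x e)
    (fun _ => C * A + 1 * B)
    (fun n => (((hF1 n).continuous_fderiv one_ne_zero).clm_apply
      continuous_const).aestronglyMeasurable) (integrable_const _)
    (fun n => by
      filter_upwards [ae_restrict_mem hΩ.measurableSet] with x hx
      rw [hF' n x hx]
      refine (norm_add_le _ _).trans (add_le_add ?_ ?_)
      · rw [norm_mul]
        exact mul_le_mul (hηC _) (hA x (subset_closure hx)) (norm_nonneg _)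
          ((abs_nonneg _).trans (hηC 0))
      · rw [norm_mul]
        exact mul_le_mul (hηb _) (hB x (subset_closure hx)) (norm_nonneg _) zero_le_one)
    (by
      filter_upwards [ae_restrict_mem hΩ.measurableSet] with x hx
      rw [hL x hx]
      simp_rw [fun n => hF' n x hx]
      rcases (hv0 x hx).eq_or_lt with h0 | hpos
      · have hmin : IsLocalMin v x := by
          filter_upwards [hΩ.mem_nhds hx] with y hy
          rw [← h0]; exact hv0 y hy
        simp [← h0, hmin.fderiv_eq_zero]
      · refine tendsto_const_nhds.congr' ?_
        filter_upwards [(tendsto_natCast_atTop_atTop.atTop_mul_const hpos).eventually_gt_atTop 2]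
          with n hn
        obtain ⟨h1, h2⟩ := hη1 (n * v x) (hn.trans_le (le_abs_self _))
        rw [h1, h2]; ring)
  simp_rw [hF_integral] at hlim
  exact tendsto_nhds_unique hlim tendsto_const_nhds

/-- The coordinates of the gradient are the partial derivatives. -/
theorem gradient_apply_eq_fderiv_single {N : ℕ} (f : EuclideanSpace ℝ (Fin N) → ℝ)
    (x : EuclideanSpace ℝ (Fin N)) (i : Fin N) :
    gradient f x i = fderiv ℝ f x (EuclideanSpace.single i 1) := by
  have h : ⟪gradient f x, EuclideanSpace.single i (1 : ℝ)⟫ =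
      fderiv ℝ f x (EuclideanSpace.single i 1) := by
    rw [gradient, InnerProductSpace.toDual_symm_apply]
  rw [← h, EuclideanSpace.inner_single_right]
  simp

theorem hasDerivAt_one_sub_rpow_neg {s : ℝ} (hs : s < 1) (p : ℝ) :
    HasDerivAt (fun s : ℝ => (1 - s) ^ (-p)) (p * (1 - s) ^ (-(p + 1))) s := by
  have h := ((hasDerivAt_id s).const_sub 1).rpow_const (p := -p) (Or.inl (sub_pos.2 hs).ne')
  refine h.congr_deriv ?_
  rw [show -p - 1 = -(p + 1) by ring]
  simp

theorem one_add_mul_le_one_sub_rpow_neg {s p : ℝ} (hs : s < 1) (hp : 0 ≤ p) :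
    1 + p * s ≤ (1 - s) ^ (-p) := by
  rw [rpow_def_of_pos (sub_pos.2 hs)]
  have h1 := add_one_le_exp (log (1 - s) * -p)
  have h2 := log_le_sub_one_of_pos (sub_pos.2 hs)
  nlinarith


/-- If `u` is a smooth solution of `−Δu + c·∇u = λ/(1−u)²` on a bounded
open set `Ω` with `C¹` boundary, `0 ≤ u`, `sup_Ω u < 1`, `u = 0` on `∂Ω`, where
`c = −∇γ + a` and `div(e^γ a) = 0` in `Ω`, then for every `t > 0`:
`(2t+1) ∫ e^γ |∇u|² (1−u)^{−(2t+2)} = λ ∫ e^γ (1−u)^{−2} ((1−u)^{−(2t+1)} − 1)`. -/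
theorem statement10 (N : ℕ) (Ω U : Set (EuclideanSpace ℝ (Fin N)))
    (hΩo : IsOpen Ω) (hΩb : Bornology.IsBounded Ω) (hΩC1 : HasC1Boundary Ω)
    (hUo : IsOpen U) (hΩU : closure Ω ⊆ U)
    (γ : EuclideanSpace ℝ (Fin N) → ℝ)
    (a : EuclideanSpace ℝ (Fin N) → EuclideanSpace ℝ (Fin N))
    (hγ : ContDiffOn ℝ (⊤ : ℕ∞) γ U) (ha : ContDiffOn ℝ (⊤ : ℕ∞) a U)
    (habd : ∃ M, ∀ x ∈ U, ‖a x‖ ≤ M)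
    (hdiv : ∀ x ∈ Ω, vdiv (fun y i => Real.exp (γ y) * a y i) x = 0)
    (c : EuclideanSpace ℝ (Fin N) → EuclideanSpace ℝ (Fin N))
    (hc : ∀ x, c x = -gradient γ x + a x)
    (lam : ℝ) (hlam : 0 < lam)
    (u : EuclideanSpace ℝ (Fin N) → ℝ) (hu : ContDiffOn ℝ (⊤ : ℕ∞) u U)
    (hu0 : ∀ x ∈ Ω, 0 ≤ u x)
    (husup : ∃ m, m < 1 ∧ ∀ x ∈ Ω, u x ≤ m)
    (hubd : ∀ x ∈ frontier Ω, u x = 0)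
    (hueq : ∀ x ∈ Ω, -(lap u x) + ⟪c x, gradient u x⟫ = lam / (1 - u x) ^ 2)
    (t : ℝ) (ht : 0 < t) :
    (2 * t + 1) *
        ∫ x in Ω, Real.exp (γ x) * ‖gradient u x‖ ^ 2 * (1 - u x) ^ (-(2 * t + 2))
      = lam * ∫ x in Ω, Real.exp (γ x) * (1 - u x) ^ (-2 : ℝ) *
          ((1 - u x) ^ (-(2 * t + 1)) - 1) := by
  obtain ⟨m, hm1, hm⟩ := husup
  set W : Set (EuclideanSpace ℝ (Fin N)) := {x ∈ U | u x < 1} with hW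
  have hWo : IsOpen W := hu.continuousOn.isOpen_inter_preimage hUo isOpen_Iio
  have hWU : W ⊆ U := fun x hx => hx.1
  have hΩ1 : ∀ x ∈ Ω, u x < 1 := fun x hx => (hm x hx).trans_lt hm1
  have hΩW : closure Ω ⊆ W := fun x hx => ⟨hΩU hx, by
    by_cases h : x ∈ Ω
    · exact hΩ1 x h
    · rw [hubd x ⟨hx, by rwa [hΩo.interior_eq]⟩]; exact one_pos⟩
  have hΩW' : Ω ⊆ W := subset_closure.trans hΩW
  have hInt_cont : ∀ f : EuclideanSpace ℝ (Fin N) → ℝ, ContinuousOn f W → IntegrableOn f Ω :=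
    fun f hf => ((hf.mono hΩW).integrableOn_compact hΩb.isCompact_closure).mono_set subset_closure
  have hg1 : ContDiffOn ℝ 1 γ W := (hγ.mono hWU).of_le (by exact_mod_cast le_top)
  have ha1 : ContDiffOn ℝ 1 a W := (ha.mono hWU).of_le (by exact_mod_cast le_top)
  have hu1 : ContDiffOn ℝ 1 u W := (hu.mono hWU).of_le (by exact_mod_cast le_top)
  have hp1 : ∀ e, ContDiffOn ℝ 1 (fun x => fderiv ℝ u x e) W := fun e =>
    ((hu.mono hWU).fderiv_of_isOpen hWo (m := 1) (by norm_cast)).clm_apply contDiffOn_const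
  have hai1 : ∀ i, ContDiffOn ℝ 1 (fun x => a x i) W := fun i =>
    contDiffOn_euclidean.1 ha1 i
  have hpos : ∀ x ∈ W, 0 < 1 - u x := fun x hx => sub_pos.2 hx.2
  have hpow : ∀ p : ℝ, ContDiffOn ℝ 1 (fun x => (1 - u x) ^ p) W := fun p =>
    (contDiffOn_const.sub hu1).rpow_const_of_ne fun x hx => (hpos x hx).ne'
  set φ : ℝ → ℝ := fun s => (1 - s) ^ (-(2 * t + 1)) - 1 with hφ
  set Φ : ℝ → ℝ := fun s => (1 - s) ^ (-(2 * t)) / (2 * t) - 1 / (2 * t) - s with hΦ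
  have hφ' : ∀ s < 1, HasDerivAt φ ((2 * t + 1) * (1 - s) ^ (-(2 * t + 2))) s := fun s hs => by
    have h := (hasDerivAt_one_sub_rpow_neg hs (2 * t + 1)).sub_const 1
    refine h.congr_deriv ?_
    ring_nf
  have hΦ' : ∀ s < 1, HasDerivAt Φ (φ s) s := fun s hs => by
    have h := (((hasDerivAt_one_sub_rpow_neg hs (2 * t)).div_const (2 * t)).sub_const
      (1 / (2 * t))).sub (hasDerivAt_id s)
    refine h.congr_deriv ?_
    simp only [hφ]
    field_simp
  have hφu : ContDiffOn ℝ 1 (fun x => φ (u x)) W := (hpow _).sub contDiffOn_const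
  have hΦu : ContDiffOn ℝ 1 (fun x => Φ (u x)) W :=
    (((hpow _).div_const _).sub contDiffOn_const).sub hu1
  have hφ0 : ∀ x ∈ Ω, 0 ≤ φ (u x) := fun x hx => by
    have := one_add_mul_le_one_sub_rpow_neg (hΩ1 x hx) (p := 2 * t + 1) (by positivity)
    have := hu0 x hx
    simp only [hφ]
    nlinarith
  have hΦ0 : ∀ x ∈ Ω, 0 ≤ Φ (u x) := fun x hx => by
    have h := one_add_mul_le_one_sub_rpow_neg (hΩ1 x hx) (p := 2 * t) (by positivity)
    have h2 : Φ (u x) = ((1 - u x) ^ (-(2 * t)) - (1 + 2 * t * u x)) / (2 * t) := by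
      simp only [hΦ]; field_simp; ring
    rw [h2]
    exact div_nonneg (sub_nonneg.2 h) (by positivity)
  have hφb : ∀ x ∈ frontier Ω, φ (u x) = 0 := fun x hx => by simp [hφ, hubd x hx]
  have hΦb : ∀ x ∈ frontier Ω, Φ (u x) = 0 := fun x hx => by simp [hΦ, hubd x hx]
  let e : Fin N → EuclideanSpace ℝ (Fin N) := fun i => EuclideanSpace.single i 1
  have hk1 : ∀ i, ContDiffOn ℝ 1 (fun x => exp (γ x) * fderiv ℝ u x (e i)) W := fun i =>
    hg1.exp.mul (hp1 (e i))
  have hk2 : ∀ i, ContDiffOn ℝ 1 (fun x => exp (γ x) * a x i) W := fun i =>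
    hg1.exp.mul (hai1 i)
  have hI1 := fun i => setIntegral_fderiv_mul_eq_zero volume hΩo hΩb hWo hΩW hφu (hk1 i)
    hφ0 hφb (e i)
  have hI2 := fun i => setIntegral_fderiv_mul_eq_zero volume hΩo hΩb hWo hΩW hΦu (hk2 i)
    hΦ0 hΦb (e i)
  have hInt_fderiv : ∀ f : EuclideanSpace ℝ (Fin N) → ℝ, ContDiffOn ℝ 1 f W → ∀ v,
      IntegrableOn (fun x => fderiv ℝ f x v) Ω := fun f hf v =>
    hInt_cont _ ((hf.continuousOn_fderiv_of_isOpen hWo le_rfl).clm_apply continuousOn_const)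
  have hsum : ∫ x in Ω, ∑ i,
      (fderiv ℝ (fun y => φ (u y) * (exp (γ y) * fderiv ℝ u y (e i))) x (e i) -
        fderiv ℝ (fun y => Φ (u y) * (exp (γ y) * a y i)) x (e i)) = 0 := by
    rw [integral_finsetSum]
    swap
    · exact fun i _ => (hInt_fderiv _ (hφu.mul (hk1 i)) (e i)).sub (hInt_fderiv _ (hΦu.mul (hk2 i)) (e i))
    refine Finset.sum_eq_zero fun i _ => ?_
    rw [integral_sub (hInt_fderiv _ (hφu.mul (hk1 i)) (e i)) (hInt_fderiv _ (hΦu.mul (hk2 i)) (e i)),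
      hI1, hI2, sub_zero]
  have hgrad : ∀ x, ‖gradient u x‖ ^ 2 = ∑ i, fderiv ℝ u x (e i) ^ 2 := fun x => by
    rw [EuclideanSpace.real_norm_sq_eq]
    simp only [gradient_apply_eq_fderiv_single, e]
  have hd : ∀ f : EuclideanSpace ℝ (Fin N) → ℝ, ContDiffOn ℝ 1 f W → ∀ x ∈ Ω,
      HasFDerivAt f (fderiv ℝ f x) x := fun f hf x hx =>
    ((hf.differentiableOn one_ne_zero).differentiableAt (hWo.mem_nhds (hΩW' hx))).hasFDerivAt
  have hpt : ∀ x ∈ Ω, ∑ i,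
      (fderiv ℝ (fun y => φ (u y) * (exp (γ y) * fderiv ℝ u y (e i))) x (e i) -
        fderiv ℝ (fun y => Φ (u y) * (exp (γ y) * a y i)) x (e i)) =
      (2 * t + 1) * (exp (γ x) * ‖gradient u x‖ ^ 2 * (1 - u x) ^ (-(2 * t + 2))) -
        lam * (exp (γ x) * (1 - u x) ^ (-2 : ℝ) * ((1 - u x) ^ (-(2 * t + 1)) - 1)) := by
    intro x hx
    have hux := hd u hu1 x hx
    have hgx := hd γ hg1 x hx
    have h1 : ∀ i, fderiv ℝ (fun y => φ (u y) * (exp (γ y) * fderiv ℝ u y (e i))) x (e i) =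
        φ (u x) * exp (γ x) * fderiv ℝ (fun y => fderiv ℝ u y (e i)) x (e i) +
        φ (u x) * exp (γ x) * (fderiv ℝ γ x (e i) * fderiv ℝ u x (e i)) +
        exp (γ x) * ((2 * t + 1) * (1 - u x) ^ (-(2 * t + 2))) * fderiv ℝ u x (e i) ^ 2 := by
      intro i
      have h : fderiv ℝ (fun y => φ (u y) * (exp (γ y) * fderiv ℝ u y (e i))) x = _ :=
        (((hφ' _ (hΩ1 x hx)).comp_hasFDerivAt x hux).mul
          (hgx.exp.mul (hd _ (hp1 (e i)) x hx))).fderiv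
      rw [h]
      simp
      ring
    have h2 : ∀ i, fderiv ℝ (fun y => Φ (u y) * (exp (γ y) * a y i)) x (e i) =
        Φ (u x) * fderiv ℝ (fun y => exp (γ y) * a y i) x (e i) +
        φ (u x) * exp (γ x) * (a x i * fderiv ℝ u x (e i)) := by
      intro i
      have h : fderiv ℝ (fun y => Φ (u y) * (exp (γ y) * a y i)) x = _ :=
        (((hΦ' _ (hΩ1 x hx)).comp_hasFDerivAt x hux).mul (hd _ (hk2 i) x hx)).fderiv
      rw [h]
      simp
      ring
    have hlap : lap u x = ∑ i, fderiv ℝ (fun y => fderiv ℝ u y (e i)) x (e i) := by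
      simp only [lap, vdiv, gradient_apply_eq_fderiv_single, e]
    have hdivx : ∑ i, fderiv ℝ (fun y => exp (γ y) * a y i) x (e i) = 0 := hdiv x hx
    have hin : ⟪c x, gradient u x⟫ = -∑ i, fderiv ℝ γ x (e i) * fderiv ℝ u x (e i) +
        ∑ i, a x i * fderiv ℝ u x (e i) := by
      rw [hc, PiLp.inner_apply, ← Finset.sum_neg_distrib, ← Finset.sum_add_distrib]
      refine Finset.sum_congr rfl fun i _ => ?_
      simp [gradient_apply_eq_fderiv_single, e]
      ring
    have heq := hueq x hx
    have h2pow : (1 - u x) ^ (-2 : ℝ) = 1 / (1 - u x) ^ 2 := by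
      rw [rpow_neg (hpos x (hΩW' hx)).le, one_div]
      norm_cast
    rw [hin, hlap, div_eq_mul_one_div, ← h2pow] at heq
    simp only [h1, h2, Finset.sum_sub_distrib, Finset.sum_add_distrib, ← Finset.mul_sum, hdivx,
      hgrad]
    have hφx : (1 - u x) ^ (-(2 * t + 1)) - 1 = φ (u x) := rfl
    rw [hφx]
    linear_combination (-(φ (u x) * exp (γ x))) * heq
  rw [setIntegral_congr_fun hΩo.measurableSet hpt, integral_sub, integral_const_mul,
    integral_const_mul] at hsum
  · exact sub_eq_zero.1 hsum
  · refine (hInt_cont _ ?_).const_mul _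
    simp_rw [hgrad]
    exact (hg1.exp.continuousOn.mul (continuousOn_finsetSum _ fun i _ =>
      (hp1 (e i)).continuousOn.pow 2)).mul (hpow _).continuousOn
  · refine (hInt_cont _ ?_).const_mul _
    exact (hg1.exp.continuousOn.mul (hpow _).continuousOn).mul hφu.continuousOn
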